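/- Let S be a proper dyadic subbase of X. The following are equivalent: (1) X is a regular space; (2) ρ_S : ↑X̃ → X is continuous; (3) the restriction ρ'_S of ρ_S to ↑X̃ ∩ 2^ω is continuous. (Proposition 3.4) -/

import Mathlib

open Set Topology TopologicalSpace

/-- The three-element set 𝕋 = {0, 1, ⊥}. `digit b` is a digit (0 or 1), `bot` is ⊥. -/
inductive TT where
  | bot : TT
  | digit : Bool → TT
  deriving DecidableEq

/-- The topology on 𝕋 whose open sets are ∅, {0}, {1}, {0,1}, 𝕋. -/
instance : TopologicalSpace TT :=
  generateFrom {{TT.digit false}, {TT.digit true}}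

/-- The pointwise order ⊑ on 𝕋^ω (⊥ ⊑ 0, ⊥ ⊑ 1, digits incomparable). -/
def TLe (p q : ℕ → TT) : Prop := ∀ k (b : Bool), p k = TT.digit b → q k = TT.digit b

/-- Compatibility in 𝕋^ω: existence of a common upper bound. -/
def TCompat (p q : ℕ → TT) : Prop := ∃ r, TLe p r ∧ TLe q r

/-- dom(p) = the set of positions where p has a digit. -/
def Tdom (p : ℕ → TT) : Set ℕ := {k | p k ≠ TT.bot}

/-- p is a finite bottomed sequence (an element of 𝕋^*). -/
def TFin (p : ℕ → TT) : Prop := (Tdom p).Finite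

/-- The truncation p|_n. -/
def trunc (p : ℕ → TT) (n : ℕ) : ℕ → TT := fun k => if k < n then p k else TT.bot

/-- The pointwise least upper bound of two (compatible) bottomed sequences. -/
def tsup (d e : ℕ → TT) : ℕ → TT := fun k => if d k = TT.bot then e k else d k

/-- A dyadic subbase of X: a family of regular open sets, pairwise exteriors,
forming a subbase of the topology of X. -/
structure DyadicSubbase (X : Type*) [t : TopologicalSpace X] where
  S : ℕ → Bool → Set X
  regOpen : ∀ n a, S n a = interior (closure (S n a))
  compl : ∀ n, S n true = (closure (S n false))ᶜ
  subbase : generateFrom {U | ∃ n a, U = S n a} = t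

variable {X : Type*} [TopologicalSpace X]

open Classical in
/-- The embedding φ_S : X → 𝕋^ω. -/
noncomputable def phi (D : DyadicSubbase X) (x : X) : ℕ → TT := fun n =>
  if x ∈ D.S n false then TT.digit false
  else if x ∈ D.S n true then TT.digit true
  else TT.bot

/-- S(p) = ⋂_{k ∈ dom p} S_{k, p(k)}. -/
def Sint (D : DyadicSubbase X) (p : ℕ → TT) : Set X :=
  {x | ∀ k (b : Bool), p k = TT.digit b → x ∈ D.S k b}

/-- S̄(p) = ⋂_{k ∈ dom p} cl(S_{k, p(k)}). -/
def SbarInt (D : DyadicSubbase X) (p : ℕ → TT) : Set X :=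
  {x | ∀ k (b : Bool), p k = TT.digit b → x ∈ closure (D.S k b)}

/-- S is a proper dyadic subbase: cl(S(e)) = S̄(e) for all finite bottomed e. -/
def IsProperDS (D : DyadicSubbase X) : Prop :=
  ∀ e, TFin e → closure (Sint D e) = SbarInt D e

/-- ↑X̃ = {p : x̃ ⊑ p for some x}. -/
def upX (D : DyadicSubbase X) : Set (ℕ → TT) := {p | ∃ x, TLe (phi D x) p}

/-- 2^ω, the bottom-free sequences. -/
def twoOmega : Set (ℕ → TT) := {p | ∀ k, p k ≠ TT.bot}

/-- K_S = {x̃|_m : x ∈ X, m ∈ ℕ}. -/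
def KS (D : DyadicSubbase X) : Set (ℕ → TT) := {e | ∃ x m, e = trunc (phi D x) m}

/-- K̂_S = {p|_m : p ∈ ↑X̃, m ∈ ℕ}. -/
def KhatS (D : DyadicSubbase X) : Set (ℕ → TT) := {e | ∃ p ∈ upX D, ∃ m, e = trunc p m}

/-- I is an ideal of the subposet K of 𝕋^ω. -/
def IsIdealOf (K I : Set (ℕ → TT)) : Prop :=
  I ⊆ K ∧ I.Nonempty ∧ (∀ d ∈ I, ∀ e ∈ I, ∃ f ∈ I, TLe d f ∧ TLe e f) ∧
    (∀ d ∈ K, ∀ e ∈ I, TLe d e → d ∈ I)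

/-- p is the pointwise least upper bound of the set I in 𝕋^ω. -/
def IsSupOf (I : Set (ℕ → TT)) (p : ℕ → TT) : Prop :=
  ∀ k (b : Bool), p k = TT.digit b ↔ ∃ e ∈ I, e k = TT.digit b

/-- D_S ⊆ 𝕋^ω: least upper bounds of ideals of K_S. -/
def DS (D : DyadicSubbase X) : Set (ℕ → TT) := {p | ∃ I, IsIdealOf (KS D) I ∧ IsSupOf I p}

/-- D̂_S ⊆ 𝕋^ω: least upper bounds of ideals of K̂_S. -/
def DhatS (D : DyadicSubbase X) : Set (ℕ → TT) := {p | ∃ I, IsIdealOf (KhatS D) I ∧ IsSupOf I p}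

/-- The limit (non-compact) elements of a subdomain E of 𝕋^ω:
those with infinite domain. -/
def limitsOf (E : Set (ℕ → TT)) : Set (ℕ → TT) := {p ∈ E | (Tdom p).Infinite}

/-- The minimal elements of a subset A of 𝕋^ω. -/
def minOf (A : Set (ℕ → TT)) : Set (ℕ → TT) := {p ∈ A | ∀ q ∈ A, TLe q p → q = p}

/-- q is an immediate successor of p in the subposet K of 𝕋^ω. -/
def ImmSucc (K : Set (ℕ → TT)) (p q : ℕ → TT) : Prop :=
  p ∈ K ∧ q ∈ K ∧ TLe p q ∧ p ≠ q ∧ ¬∃ r ∈ K, TLe p r ∧ p ≠ r ∧ TLe r q ∧ r ≠ q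

/-- A Hausdorff space is adhesive if it has at least two points and the closures
of any two nonempty open sets intersect. -/
def Adhesive (Y : Type*) [TopologicalSpace Y] : Prop :=
  (∃ y z : Y, y ≠ z) ∧
    ∀ U V : Set Y, IsOpen U → IsOpen V → U.Nonempty → V.Nonempty →
      (closure U ∩ closure V).Nonempty

/-- A space is strongly nonadhesive if every open subspace is nonadhesive. -/
def StronglyNonadhesive (Y : Type*) [TopologicalSpace Y] : Prop :=
  ∀ U : Set Y, IsOpen U → ¬ Adhesive U

theorem aux_disj {X : Type*} [TopologicalSpace X] (D : DyadicSubbase X) (k : ℕ) (b : Bool) (x : X) :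
    x ∈ closure (D.S k b) ↔ x ∉ D.S k (!b) := by
  cases b
  · simp [D.compl k]
  · have h : D.S k false = (closure (D.S k true))ᶜ := by
      conv_lhs => rw [D.regOpen k false]
      rw [D.compl k, interior_eq_compl_closure_compl]
    simp only [Bool.not_true]
    rw [h]
    simp

theorem aux_open {X : Type*} [TopologicalSpace X] (D : DyadicSubbase X) (k : ℕ) (b : Bool) :
    IsOpen (D.S k b) := by
  rw [D.regOpen k b]; exact isOpen_interior

theorem aux_phi {X : Type*} [TopologicalSpace X] (D : DyadicSubbase X) (k : ℕ) (b : Bool) (x : X) :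
    phi D x k = TT.digit b ↔ x ∈ D.S k b := by
  have h : x ∈ D.S k false → x ∉ D.S k true := fun h =>
    (aux_disj D k false x).1 (subset_closure h)
  unfold phi
  cases b <;> split_ifs <;> simp_all

theorem aux_mem {X : Type*} [TopologicalSpace X] (D : DyadicSubbase X) (x : X) (p : ℕ → TT)
    (h : TLe (phi D x) p) : x ∈ SbarInt D p := by
  intro k b hk
  rw [aux_disj]
  intro hx
  have := h k _ ((aux_phi D k _ x).2 hx)
  rw [hk] at this
  cases b <;> simp at this

theorem aux_nhd {X : Type*} [t : TopologicalSpace X] (D : DyadicSubbase X) (x : X) (U : Set X)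
    (hU : IsOpen U) (hx : x ∈ U) : ∃ N, Sint D (trunc (phi D x) N) ⊆ U := by
  have hU' : GenerateOpen {U | ∃ n a, U = D.S n a} U := by
    have := hU
    rw [← D.subbase] at this
    exact this
  clear hU
  have mono : ∀ M N, M ≤ N →
      Sint D (trunc (phi D x) N) ⊆ Sint D (trunc (phi D x) M) := by
    intro M N h y hy k b hk
    apply hy k b
    unfold trunc at *
    split_ifs at hk with h1
    rw [if_pos (by omega)]; exact hk
  induction hU' with
  | basic s hs =>
    obtain ⟨n, a, rfl⟩ := hs
    refine ⟨n + 1, fun y hy => hy n a ?_⟩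
    simp [trunc, aux_phi, hx]
  | univ => exact ⟨0, subset_univ _⟩
  | inter s t _ _ h1 h2 =>
    obtain ⟨M, hM⟩ := h1 hx.1
    obtain ⟨N, hN⟩ := h2 hx.2
    exact ⟨max M N, subset_inter ((mono _ _ (le_max_left _ _)).trans hM)
      ((mono _ _ (le_max_right _ _)).trans hN)⟩
  | sUnion K _ ih =>
    obtain ⟨s, hs, hxs⟩ := hx
    obtain ⟨N, hN⟩ := ih s hs hxs
    exact ⟨N, hN.trans (subset_sUnion_of_mem hs)⟩

theorem aux_digit_open (b : Bool) : IsOpen ({TT.digit b} : Set TT) := by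
  apply isOpen_generateFrom_of_mem
  cases b <;> simp

/-- Proposition 3.4: X regular ⟺ ρ_S continuous on ↑X̃ ⟺ ρ'_S continuous on ↑X̃ ∩ 2^ω. -/
theorem stmt_6 {X : Type*} [TopologicalSpace X] [T2Space X] [SecondCountableTopology X]
    (D : DyadicSubbase X) (hD : IsProperDS D)
    (ρ : (ℕ → TT) → X) (hρ : ∀ p ∈ upX D, SbarInt D p = {ρ p}) :
    (RegularSpace X ↔ ContinuousOn ρ (upX D)) ∧
    (ContinuousOn ρ (upX D) ↔ ContinuousOn ρ (upX D ∩ twoOmega)) := by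
  have hval : ∀ x p, TLe (phi D x) p → ρ p = x := by
    intro x p h
    have := aux_mem D x p h
    rw [hρ p ⟨x, h⟩] at this
    exact this.symm
  have h12 : RegularSpace X → ContinuousOn ρ (upX D) := by
    intro hreg p hp
    obtain ⟨x, hx⟩ := hp
    have hpx := hval x p hx
    rw [ContinuousWithinAt, hpx]
    intro U hU
    obtain ⟨V, hV, hVc, hVU⟩ := exists_mem_nhds_isClosed_subset hU
    obtain ⟨N, hN⟩ := aux_nhd D x (interior V) isOpen_interior (mem_interior_iff_mem_nhds.2 hV)
    have hfin : TFin (trunc (phi D x) N) := by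
      apply (Set.finite_lt_nat N).subset
      intro k hk
      by_contra h
      exact hk (if_neg h)
    have hcl : SbarInt D (trunc (phi D x) N) ⊆ U := by
      rw [← hD _ hfin]
      exact (closure_minimal (hN.trans interior_subset) hVc).trans hVU
    have hev : ∀ᶠ q in 𝓝 p, ∀ k ∈ {k | k < N}, ∀ b, phi D x k = TT.digit b → q k = TT.digit b := by
      rw [Filter.eventually_all_finite (Set.finite_lt_nat N)]
      intro k _
      rw [Filter.eventually_all]
      intro b
      by_cases h : phi D x k = TT.digit b
      · have : ∀ᶠ q in 𝓝 p, q k ∈ ({TT.digit b} : Set TT) :=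
          ((aux_digit_open b).preimage (continuous_apply k)).mem_nhds (hx k b h)
        exact this.mono fun q hq _ => hq
      · simp [h]
    rw [Filter.mem_map]
    filter_upwards [nhdsWithin_le_nhds hev, self_mem_nhdsWithin] with q hq hqu
    apply hcl
    have : ρ q ∈ SbarInt D q := by rw [hρ q hqu]; rfl
    intro k b hk
    apply this
    unfold trunc at hk
    split_ifs at hk with h
    exact hq k h b hk
  have h23 : ContinuousOn ρ (upX D) → ContinuousOn ρ (upX D ∩ twoOmega) :=
    fun h => h.mono inter_subset_left
  have h31 : ContinuousOn ρ (upX D ∩ twoOmega) → RegularSpace X := by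
    intro hc
    apply RegularSpace.of_exists_mem_nhds_isClosed_subset
    intro x U hU
    let c : (ℕ → Bool) → (ℕ → TT) := fun q k => TT.digit (q k)
    have hcc : Continuous c :=
      continuous_pi fun k => (continuous_of_discreteTopology).comp (continuous_apply k)
    let F : ℕ → Set (ℕ → Bool) := fun n => {q | ∀ k < n, ∀ b, phi D x k = TT.digit b → q k = b}
    have hFc : ∀ n, IsClosed (F n) := by
      intro n
      simp only [F, setOf_forall]
      refine isClosed_iInter fun k => isClosed_iInter fun _ => isClosed_iInter fun b =>
        isClosed_iInter fun _ => ?_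
      exact isClosed_eq (continuous_apply k) continuous_const
    have hFd : Antitone F := fun m n h q hq k hk => hq k (hk.trans_le h)
    obtain ⟨W, hWo, hW⟩ := (continuousOn_iff'.1 hc) (interior U) isOpen_interior
    obtain ⟨n, hn⟩ : ∃ n, F n ⊆ c ⁻¹' W := by
      apply exists_subset_nhds_of_compactSpace (hFd.directed_ge) hFc
      intro q hq
      apply (hWo.preimage hcc).mem_nhds
      have hle : TLe (phi D x) (c q) := by
        intro k b hk
        exact congrArg TT.digit (mem_iInter.1 hq (k + 1) k (Nat.lt_succ_self k) b hk)
      have : c q ∈ ρ ⁻¹' interior U ∩ (upX D ∩ twoOmega) := by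
        refine ⟨?_, ⟨x, hle⟩, fun k => by simp [c]⟩
        rw [mem_preimage, hval x _ hle]
        exact mem_interior_iff_mem_nhds.2 hU
      rw [hW] at this
      exact this.1
    refine ⟨{y | ∀ k ∈ {k | k < n}, ∀ b, phi D x k = TT.digit b → y ∈ closure (D.S k b)}, ?_, ?_, ?_⟩
    · change ∀ᶠ y in 𝓝 x, ∀ k ∈ {k | k < n}, ∀ b, phi D x k = TT.digit b → y ∈ closure (D.S k b)
      rw [Filter.eventually_all_finite (Set.finite_lt_nat n)]
      intro k _
      rw [Filter.eventually_all]
      intro b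
      by_cases h : phi D x k = TT.digit b
      · have : ∀ᶠ y in 𝓝 x, y ∈ D.S k b := (aux_open D k b).mem_nhds ((aux_phi D k b x).1 h)
        exact this.mono fun y hy _ => subset_closure hy
      · simp [h]
    · simp only [setOf_forall]
      exact isClosed_iInter fun k => isClosed_iInter fun _ => isClosed_iInter fun b =>
        isClosed_iInter fun _ => isClosed_closure
    · intro y hy
      have hex : ∀ k, ∃ b, (∀ a, phi D y k = TT.digit a → b = a) ∧
          (k < n → ∀ a, phi D x k = TT.digit a → b = a) := by
        intro k
        cases h : phi D y k with
        | digit b =>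
          refine ⟨b, by simp, fun hk a ha => ?_⟩
          have h1 := (aux_disj D k a y).1 (hy k hk a ha)
          have h2 := (aux_phi D k b y).1 h
          by_contra hne
          have : b = !a := by cases a <;> cases b <;> simp_all
          exact h1 (this ▸ h2)
        | bot =>
          cases h' : phi D x k with
          | digit b => exact ⟨b, by simp, by simp⟩
          | bot => exact ⟨false, by simp, by simp⟩
      choose q hq1 hq2 using hex
      have hle : TLe (phi D y) (c q) := fun k b hk => congrArg TT.digit (hq1 k b hk)
      have hqW : c q ∈ W := hn (fun k hk b hb => hq2 k hk b hb)
      have : c q ∈ W ∩ (upX D ∩ twoOmega) := ⟨hqW, ⟨y, hle⟩, fun k => by simp [c]⟩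
      rw [← hW] at this
      have h3 := this.1
      rw [mem_preimage, hval y _ hle] at h3
      exact interior_subset h3
  exact ⟨⟨h12, fun h => h31 (h23 h)⟩, ⟨h23, fun h => h12 (h31 h)⟩⟩
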